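/- Let u : ℝ³ → ℝ be a smooth solution of the rdDym equation u_ty = u_x u_xy − u_y u_xx. Let χ̂ : ℝ³ → ℝ be a smooth solution of the linearized rdDym equation ℓ_E(χ̂) = 0, and suppose χ : ℝ³ → ℝ is a smooth function satisfying the first-order system ∂_x χ = ∂_t χ̂ − u_x ∂_x χ̂ + u_xx χ̂ and ∂_y χ = −u_y ∂_x χ̂ + u_xy χ̂. Then χ also satisfies ℓ_E(χ) = 0. (The system defines the recursion operator R₋, inverse to R₊, for shadows of symmetries of the rdDym equation.) -/

import Mathlib

noncomputable section

/-- Partial derivative with respect to the first variable (`x`). -/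
def Dx (f : ℝ → ℝ → ℝ → ℝ) (x y t : ℝ) : ℝ := deriv (fun x' => f x' y t) x

/-- Partial derivative with respect to the second variable (`y`). -/
def Dy (f : ℝ → ℝ → ℝ → ℝ) (x y t : ℝ) : ℝ := deriv (fun y' => f x y' t) y

/-- Partial derivative with respect to the third variable (`t`). -/
def Dt (f : ℝ → ℝ → ℝ → ℝ) (x y t : ℝ) : ℝ := deriv (fun t' => f x y t') t

/-- Smoothness of a function of three real variables `(x, y, t)`. -/
def Smooth3 (f : ℝ → ℝ → ℝ → ℝ) : Prop :=
  ContDiff ℝ (⊤ : ℕ∞) (fun p : ℝ × ℝ × ℝ => f p.1 p.2.1 p.2.2)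

/-- Linearization of the rdDym equation `u_ty = u_x u_xy - u_y u_xx` at a solution `u`. -/
def linRdDym (u φ : ℝ → ℝ → ℝ → ℝ) (x y t : ℝ) : ℝ :=
  Dt (Dy φ) x y t - Dx u x y t * Dx (Dy φ) x y t + Dy u x y t * Dx (Dx φ) x y t
    - Dx (Dy u) x y t * Dx φ x y t + Dx (Dx u) x y t * Dy φ x y t

/-- The function of a point of `ℝ × ℝ × ℝ` corresponding to a function of three variables. -/
def uncurry3 (f : ℝ → ℝ → ℝ → ℝ) (p : ℝ × ℝ × ℝ) : ℝ := f p.1 p.2.1 p.2.2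

namespace Smooth3

variable {f : ℝ → ℝ → ℝ → ℝ}

lemma contDiff_uncurry3 (hf : Smooth3 f) : ContDiff ℝ (⊤ : ℕ∞) (uncurry3 f) := hf

lemma differentiable_uncurry3 (hf : Smooth3 f) : Differentiable ℝ (uncurry3 f) :=
  hf.contDiff_uncurry3.differentiable (by simp)

lemma hasDerivAt_fderiv_x (hf : Smooth3 f) (x y t : ℝ) :
    HasDerivAt (fun x' => f x' y t) (fderiv ℝ (uncurry3 f) (x, y, t) (1, 0, 0)) x :=
  HasFDerivAt.comp_hasDerivAt (l := uncurry3 f) x (hf.differentiable_uncurry3 (x, y, t)).hasFDerivAt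
    ((hasDerivAt_id x).prodMk ((hasDerivAt_const x y).prodMk (hasDerivAt_const x t)))

lemma hasDerivAt_fderiv_y (hf : Smooth3 f) (x y t : ℝ) :
    HasDerivAt (fun y' => f x y' t) (fderiv ℝ (uncurry3 f) (x, y, t) (0, 1, 0)) y :=
  HasFDerivAt.comp_hasDerivAt (l := uncurry3 f) y (hf.differentiable_uncurry3 (x, y, t)).hasFDerivAt
    ((hasDerivAt_const y x).prodMk ((hasDerivAt_id y).prodMk (hasDerivAt_const y t)))

lemma hasDerivAt_fderiv_t (hf : Smooth3 f) (x y t : ℝ) :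
    HasDerivAt (fun t' => f x y t') (fderiv ℝ (uncurry3 f) (x, y, t) (0, 0, 1)) t :=
  HasFDerivAt.comp_hasDerivAt (l := uncurry3 f) t (hf.differentiable_uncurry3 (x, y, t)).hasFDerivAt
    ((hasDerivAt_const t x).prodMk ((hasDerivAt_const t y).prodMk (hasDerivAt_id t)))

lemma uncurry3_Dx (hf : Smooth3 f) :
    uncurry3 (Dx f) = fun p => fderiv ℝ (uncurry3 f) p (1, 0, 0) :=
  funext fun p => (hf.hasDerivAt_fderiv_x p.1 p.2.1 p.2.2).deriv

lemma uncurry3_Dy (hf : Smooth3 f) :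
    uncurry3 (Dy f) = fun p => fderiv ℝ (uncurry3 f) p (0, 1, 0) :=
  funext fun p => (hf.hasDerivAt_fderiv_y p.1 p.2.1 p.2.2).deriv

lemma uncurry3_Dt (hf : Smooth3 f) :
    uncurry3 (Dt f) = fun p => fderiv ℝ (uncurry3 f) p (0, 0, 1) :=
  funext fun p => (hf.hasDerivAt_fderiv_t p.1 p.2.1 p.2.2).deriv

lemma contDiff_fderiv (hf : Smooth3 f) : ContDiff ℝ (⊤ : ℕ∞) (fderiv ℝ (uncurry3 f)) :=
  hf.contDiff_uncurry3.fderiv_right (by simp)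

protected lemma Dx (hf : Smooth3 f) : Smooth3 (Dx f) := by
  change ContDiff ℝ _ (uncurry3 (Dx f))
  rw [hf.uncurry3_Dx]
  exact hf.contDiff_fderiv.clm_apply contDiff_const

protected lemma Dy (hf : Smooth3 f) : Smooth3 (Dy f) := by
  change ContDiff ℝ _ (uncurry3 (Dy f))
  rw [hf.uncurry3_Dy]
  exact hf.contDiff_fderiv.clm_apply contDiff_const

protected lemma Dt (hf : Smooth3 f) : Smooth3 (Dt f) := by
  change ContDiff ℝ _ (uncurry3 (Dt f))
  rw [hf.uncurry3_Dt]
  exact hf.contDiff_fderiv.clm_apply contDiff_const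

lemma hasDerivAt_x (hf : Smooth3 f) (x y t : ℝ) :
    HasDerivAt (fun x' => f x' y t) (Dx f x y t) x :=
  (hf.hasDerivAt_fderiv_x x y t).differentiableAt.hasDerivAt

lemma hasDerivAt_t (hf : Smooth3 f) (x y t : ℝ) :
    HasDerivAt (fun t' => f x y t') (Dt f x y t) t :=
  (hf.hasDerivAt_fderiv_t x y t).differentiableAt.hasDerivAt

/-- Partial derivatives in `x` and `t` of a smooth function commute. -/
lemma Dx_Dt_comm (hf : Smooth3 f) (x y t : ℝ) :
    Dx (Dt f) x y t = Dt (Dx f) x y t := by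
  have hd := hf.contDiff_fderiv.differentiable (by simp) (x, y, t)
  have hsymm := (hf.contDiff_uncurry3.contDiffAt (x := (x, y, t))).isSymmSndFDerivAt
    (by simpa using WithTop.coe_le_coe.2 (le_top : (2 : ℕ∞) ≤ ⊤))
  have hxt := (hf.Dt.hasDerivAt_fderiv_x x y t).deriv
  have htx := (hf.Dx.hasDerivAt_fderiv_t x y t).deriv
  rw [hf.uncurry3_Dt, fderiv_clm_apply hd (differentiableAt_const _)] at hxt
  rw [hf.uncurry3_Dx, fderiv_clm_apply hd (differentiableAt_const _)] at htx
  refine hxt.trans (Eq.trans ?_ htx.symm)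
  simpa using hsymm (1, 0, 0) (0, 0, 1)

end Smooth3

/-- The inverse recursion operator `R₋` of the rdDym equation maps shadows to shadows. -/
theorem rdDym_recursion_minus
    (u : ℝ → ℝ → ℝ → ℝ) (hu : Smooth3 u)
    (husol : ∀ x y t : ℝ, Dt (Dy u) x y t = Dx u x y t * Dx (Dy u) x y t - Dy u x y t * Dx (Dx u) x y t)
    (χhat : ℝ → ℝ → ℝ → ℝ) (hχhat : Smooth3 χhat)
    (hχhatsh : ∀ x y t : ℝ, linRdDym u χhat x y t = 0)
    (χ : ℝ → ℝ → ℝ → ℝ) (hχ : Smooth3 χ)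
    (hsys_x : ∀ x y t : ℝ,
      Dx χ x y t = Dt χhat x y t - Dx u x y t * Dx χhat x y t + Dx (Dx u) x y t * χhat x y t)
    (hsys_y : ∀ x y t : ℝ,
      Dy χ x y t = -Dy u x y t * Dx χhat x y t + Dx (Dy u) x y t * χhat x y t) :
    ∀ x y t : ℝ, linRdDym u χ x y t = 0 := by
  intro x y t
  have hDxDxu := hu.Dx.Dx.hasDerivAt_x x y t
  have hDxu := hu.Dx.hasDerivAt_x x y t
  have hDyu := hu.Dy.hasDerivAt_x x y t
  have hDxDyu := hu.Dy.Dx.hasDerivAt_x x y t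
  have hhat := hχhat.hasDerivAt_x x y t
  have hDxhat := hχhat.Dx.hasDerivAt_x x y t
  have hχyt := hχ.Dy.hasDerivAt_t x y t
  have hχyx := hχ.Dy.hasDerivAt_x x y t
  have hχxx := hχ.Dx.hasDerivAt_x x y t
  have husol_x := hu.Dy.Dt.hasDerivAt_x x y t
  simp only [hsys_y] at hχyt hχyx
  simp only [hsys_x] at hχxx
  simp only [husol] at husol_x
  replace hχyt := hχyt.unique (((hu.Dy.hasDerivAt_t x y t).neg.mul
    (hχhat.Dx.hasDerivAt_t x y t)).add
      ((hu.Dy.Dx.hasDerivAt_t x y t).mul (hχhat.hasDerivAt_t x y t)))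
  replace hχyx := hχyx.unique ((hDyu.neg.mul hDxhat).add (hDxDyu.mul hhat))
  replace hχxx := hχxx.unique
    (((hχhat.Dt.hasDerivAt_x x y t).sub (hDxu.mul hDxhat)).add (hDxDxu.mul hhat))
  replace husol_x := husol_x.unique ((hDxu.mul hDxDyu).sub (hDyu.mul hDxDxu))
  rw [hu.Dy.Dx_Dt_comm] at husol_x
  rw [hχhat.Dx_Dt_comm] at hχxx
  simp only [Pi.neg_apply] at hχyt hχyx
  rw [linRdDym, hχyt, hχyx, hχxx, hsys_x, hsys_y, husol_x, husol]
  ring
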